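/- Let s ≥ 3 be an odd integer. Any finite simple graph G with maximum degree Δ(G) < s, matching number ν(G) < s, no isolated vertices, and exactly s(s-1) edges is isomorphic to the disjoint union of two copies of the complete graph K_s. -/

import Mathlib

open SimpleGraph

/-- `M` is a matching of `G`: a set of edges of `G` that are pairwise vertex-disjoint. -/
def IsMatchingSet {V : Type} (G : SimpleGraph V) (M : Set (Sym2 V)) : Prop :=
  M ⊆ G.edgeSet ∧ M.Pairwise fun e f => ∀ v : V, v ∈ e → v ∉ f

/-- The matching number `ν(G)`: the maximum size of a matching in `G`. -/
noncomputable def nu {V : Type} (G : SimpleGraph V) : ℕ :=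
  sSup {n | ∃ M : Set (Sym2 V), IsMatchingSet G M ∧ M.ncard = n}

/-- `v` is saturated (covered) by the matching `M`. -/
def MSaturates {V : Type} (M : Set (Sym2 V)) (v : V) : Prop := ∃ e ∈ M, v ∈ e

/-- The edges of the walk `p` alternate: the `i`-th edge belongs to `M` iff `i` is odd
(so the walk starts with a non-matching edge). -/
def IsAlternating {V : Type} (M : Set (Sym2 V)) {G : SimpleGraph V} {a b : V}
    (p : G.Walk a b) : Prop :=
  ∀ (i : ℕ) (h : i < p.edges.length), (p.edges[i]'h ∈ M ↔ Odd i)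

/-- A star path of `G` relative to `M`: a path of even length, alternating starting with a
non-matching edge, whose initial vertex is `M`-unsaturated. -/
def IsStarPath {V : Type} (M : Set (Sym2 V)) {G : SimpleGraph V} {a b : V}
    (p : G.Walk a b) : Prop :=
  p.IsPath ∧ Even p.length ∧ ¬ MSaturates M a ∧ IsAlternating M p

/-- `v` is a star vertex of `G` relative to `M`: some star path terminates at `v`. -/
def IsStarVertex {V : Type} (G : SimpleGraph V) (M : Set (Sym2 V)) (v : V) : Prop :=
  ∃ a : V, ∃ p : G.Walk a v, IsStarPath M p

/-- An `M`-augmenting path: a path of odd length, alternating starting and ending with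
non-matching edges, both of whose endpoints are `M`-unsaturated. -/
def IsAugPath {V : Type} (M : Set (Sym2 V)) {G : SimpleGraph V} {a b : V}
    (p : G.Walk a b) : Prop :=
  p.IsPath ∧ Odd p.length ∧ ¬ MSaturates M a ∧ ¬ MSaturates M b ∧ IsAlternating M p

/-- `G ∈ F(d,m)`: `G` is a finite simple graph with maximum degree `< d` and matching
number `< m`, edge-maximal with this property among all finite graphs on vertex sets
containing `V(G)`. -/
def MemF (d m : ℕ) {V : Type} [Fintype V] (G : SimpleGraph V) : Prop :=
  (∀ v : V, (G.neighborSet v).ncard < d) ∧ nu G < m ∧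
  ∀ (W : Type) [Fintype W] (f : V ↪ W) (G' : SimpleGraph W),
    (∀ u v : V, G.Adj u v → G'.Adj (f u) (f v)) →
    G.edgeSet.ncard < G'.edgeSet.ncard →
    (∃ w : W, d ≤ (G'.neighborSet w).ncard) ∨ m ≤ nu G'

/-- The join of `G` with the complete graph on `D`. -/
def joinComplete {V : Type} (G : SimpleGraph V) (D : Type) : SimpleGraph (V ⊕ D) where
  Adj
    | .inl u, .inl v => G.Adj u v
    | x, y => x ≠ y
  symm := ⟨by
    rintro (u | u) (v | v) h
    · exact G.symm.symm _ _ h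
    all_goals exact Ne.symm h⟩
  loopless := ⟨by
    rintro (u | u) h
    · exact G.loopless.irrefl u h
    · exact h rfl⟩

theorem joinComplete_adj_inr {V D : Type} (G : SimpleGraph V) {x : V ⊕ D} {d : D}
    (h : x ≠ .inr d) : (joinComplete G D).Adj x (.inr d) := by
  cases x <;> exact h

theorem IsMatchingSet.ncard_le_nu {V : Type} [Finite V] {G : SimpleGraph V} {M : Set (Sym2 V)}
    (hM : IsMatchingSet G M) : M.ncard ≤ nu G := by
  refine le_csSup ⟨Nat.card (Sym2 V), ?_⟩ ⟨M, hM, rfl⟩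
  rintro _ ⟨N, -, rfl⟩
  exact Set.ncard_le_card N

/-- Restricting a perfect matching of the join of `G` with `D` to `G` leaves at most `|D|`
vertices uncovered. -/
theorem card_le_of_isPerfectMatching_joinComplete {V D : Type} [Fintype V] [Fintype D]
    {G : SimpleGraph V} {M : (joinComplete G D).Subgraph} (hM : M.IsPerfectMatching) :
    Fintype.card V ≤ 2 * nu G + Fintype.card D := by
  classical
  rw [Subgraph.isPerfectMatching_iff] at hM
  choose p hp hpu using hM
  have hpp : ∀ x, p (p x) = x := fun x => (hpu _ _ (hp x).symm).symm
  let N : Set (Sym2 V) := {e | ∃ u v, e = s(u, v) ∧ p (.inl u) = .inl v}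
  have hN : IsMatchingSet G N := by
    constructor
    · rintro _ ⟨u, v, rfl, h⟩
      have := M.adj_sub (hp (.inl u))
      rw [h] at this
      exact this
    · rintro _ ⟨u, v, rfl, h⟩ _ ⟨u', v', rfl, h'⟩ hne w hw hw'
      apply hne
      have h2 := hpp (.inl u)
      have h2' := hpp (.inl u')
      rw [h] at h2
      rw [h'] at h2'
      simp only [Sym2.mem_iff] at hw hw'
      rcases hw with rfl | rfl <;> rcases hw' with rfl | rfl <;> simp_all [Sym2.eq_swap]
  let S : Finset V := {u | ∃ v, p (.inl u) = .inl v}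
  have h1 : Sᶜ.card ≤ Fintype.card D := by
    rw [← Finset.card_univ,
      ← Finset.card_map (s := Finset.univ) (⟨_, Sum.inr_injective⟩ : D ↪ V ⊕ D)]
    refine Finset.card_le_card_of_injOn (fun u => p (.inl u)) ?_ ?_
    · intro u hu
      rcases h : p (.inl u) with v | d
      · simp [S, h] at hu
      · simp [h]
    · intro u hu v hv huv
      simpa [hpp] using congrArg p huv
  have h2 : S.card ≤ 2 * N.ncard := by
    rw [Set.ncard_eq_toFinset_card' N]
    have hex : ∀ u : V, u ∈ S → ∃ v, p (.inl u) = .inl v := by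
      intro u hu
      simpa [S] using hu
    choose! g hg using hex
    refine Finset.card_le_mul_card_image_of_maps_to (f := fun u => s(u, g u)) ?_ 2 ?_
    · intro u hu
      rw [Set.mem_toFinset]
      exact ⟨u, g u, rfl, hg u hu⟩
    · rintro e -
      induction e with | _ a b
      refine (Finset.card_le_card (t := {a, b}) ?_).trans Finset.card_le_two
      intro u hu
      have : u ∈ s(a, b) := by
        rw [← (Finset.mem_filter.1 hu).2]
        exact Sym2.mem_mk_left _ _
      simpa using this
  have h3 := hN.ncard_le_nu
  have h4 := Finset.card_add_card_compl S
  lia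

/-- A weak form of the Tutte–Berge formula: a graph with small matching number has a set `A` of
vertices whose removal breaks the graph into pieces that certify the bound. -/
theorem exists_barrier_of_nu_lt {V : Type} [Fintype V] [DecidableEq V] {G : SimpleGraph V} {s : ℕ}
    (hν : nu G < s) :
    ∃ (C : Type) (_ : Fintype C) (_ : DecidableEq C) (A : Finset V) (f : V → C),
      (∀ u v, G.Adj u v → u ∉ A → v ∉ A → f u = f v) ∧
      A.card + ∑ c, (Finset.card {v | v ∉ A ∧ f v = c}) / 2 < s := by
  classical
  by_cases hn : Fintype.card V < 2 * s
  · refine ⟨Unit, inferInstance, inferInstance, ∅, fun _ => (), by simp, ?_⟩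
    simp
    lia
  push Not at hn
  let D := Fin (Fintype.card V - 2 * s)
  let H := joinComplete G D
  have hcard : Nat.card (V ⊕ D) = 2 * (Fintype.card V - s) := by
    simp [D]
    lia
  obtain ⟨U, hU⟩ : ∃ U, H.IsTutteViolator U := by
    refine exists_isTutteViolator (fun M hM => ?_) (by rw [hcard]; exact even_two_mul _)
    have := card_le_of_isPerfectMatching_joinComplete hM
    simp only [D, Fintype.card_fin] at this
    lia
  rw [IsTutteViolator] at hU
  set K := ((⊤ : H.Subgraph).deleteVerts U).coe
  have hVK : Nat.card ((⊤ : H.Subgraph).deleteVerts U).verts + U.ncard = Nat.card (V ⊕ D) := by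
    have := Set.ncard_add_ncard_compl U
    rw [Nat.card_coe_set_eq, ← this, add_comm]
    congr 2
    ext; simp
  have hpar := K.odd_ncard_oddComponents
  have hq : U.ncard + 2 ≤ K.oddComponents.ncard := by
    rw [Nat.odd_iff, Nat.odd_iff] at hpar
    lia
  have hD : ∀ d, Sum.inr d ∈ U := by
    by_contra! ⟨d, hd⟩
    have hsub : Subsingleton K.ConnectedComponent := by
      have hd' : Sum.inr d ∈ ((⊤ : H.Subgraph).deleteVerts U).verts := by simpa using hd
      have : ∀ c : K.ConnectedComponent, c = K.connectedComponentMk ⟨_, hd'⟩ := by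
        intro c
        induction c using ConnectedComponent.ind with | _ x
        rw [ConnectedComponent.eq]
        by_cases hx : x = ⟨_, hd'⟩
        · rw [hx]
        · refine Adj.reachable ?_
          have h1 : H.Adj x.1 (.inr d) :=
            joinComplete_adj_inr G fun h => hx (Subtype.ext h)
          have h2 := x.2
          simp at h2
          simp [K, hd, h1, h2]
      exact ⟨fun a b => (this a).trans (this b).symm⟩
    have := Set.ncard_le_card K.oddComponents
    have := Finite.card_le_one_iff_subsingleton.2 hsub
    lia
  let A : Finset V := {v | .inl v ∈ U}
  have hmem : ∀ v, v ∉ A → Sum.inl v ∈ ((⊤ : H.Subgraph).deleteVerts U).verts := by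
    intro v hv
    simpa [A] using hv
  have hUA : U.ncard = A.card + (Fintype.card V - 2 * s) := by
    have : U = ((A.disjSum (Finset.univ : Finset D) : Finset (V ⊕ D)) : Set (V ⊕ D)) := by
      ext (v | d) <;> simp [A, hD]
    rw [this, Set.ncard_coe_finset, Finset.card_disjSum]
    simp [D]
  have hne : Nonempty K.ConnectedComponent := by
    have : K.oddComponents.ncard ≠ 0 := by lia
    obtain ⟨c, -⟩ := Set.nonempty_of_ncard_ne_zero this
    exact ⟨c⟩
  let f : V → K.ConnectedComponent := fun v =>
    if h : v ∉ A then K.connectedComponentMk ⟨.inl v, hmem v h⟩ else hne.some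
  have hf : ∀ v (h : v ∉ A), f v = K.connectedComponentMk ⟨.inl v, hmem v h⟩ :=
    fun v h => dif_pos h
  have hfc : ∀ c, Finset.card {v | v ∉ A ∧ f v = c} = c.supp.ncard := by
    intro c
    rw [← Set.ncard_coe_finset]
    refine Set.ncard_congr (fun v hv => ⟨.inl v, hmem v (by simp at hv; exact hv.1)⟩) ?_ ?_ ?_
    · intro v hv
      simp only [Finset.coe_filter, Finset.mem_univ, true_and, Set.mem_ofPred_eq] at hv
      rw [ConnectedComponent.mem_supp_iff, ← hf v hv.1, hv.2]
    · intro u v hu hv h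
      simpa using h
    · rintro ⟨v | d, hx⟩ hc
      · have hv : v ∉ A := by simpa [A] using hx
        refine ⟨v, ?_, rfl⟩
        rw [ConnectedComponent.mem_supp_iff] at hc
        simp [hv, hf v hv, hc]
      · simp [hD] at hx
  refine ⟨K.ConnectedComponent, Fintype.ofFinite _, Classical.decEq _, A, f, ?_, ?_⟩
  · intro u v huv hu hv
    rw [hf u hu, hf v hv, ConnectedComponent.eq]
    refine Adj.reachable ?_
    have h1 : H.Adj (.inl u) (.inl v) := huv
    simp only [A, Finset.mem_filter, Finset.mem_univ, true_and] at hu hv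
    simp [K, h1, hu, hv]
  · let _ := Fintype.ofFinite K.ConnectedComponent
    have h1 : ∑ c, Finset.card {v | v ∉ A ∧ f v = c} = Aᶜ.card := by
      rw [Finset.card_eq_sum_card_fiberwise (f := f) (t := Finset.univ) (by simp)]
      refine Finset.sum_congr rfl fun c _ => ?_
      congr 1
      ext v
      simp
    have h2 : ∑ c, Finset.card {v | v ∉ A ∧ f v = c} % 2 = K.oddComponents.ncard := by
      rw [Set.ncard_eq_toFinset_card', Set.toFinset_ofPred, Finset.card_filter]
      refine Finset.sum_congr rfl fun c _ => ?_
      rw [hfc]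
      split_ifs with h
      · exact Nat.odd_iff.1 h
      · exact Nat.not_odd_iff.1 h
    have h3 : ∑ c, Finset.card {v | v ∉ A ∧ f v = c} =
        2 * ∑ c, Finset.card {v | v ∉ A ∧ f v = c} / 2 +
          ∑ c, Finset.card {v | v ∉ A ∧ f v = c} % 2 := by
      rw [Finset.mul_sum, ← Finset.sum_add_distrib]
      exact Finset.sum_congr rfl fun c _ => (Nat.div_add_mod _ 2).symm
    have h4 := Finset.card_add_card_compl A
    convert (by lia : A.card + ∑ c, Finset.card {v | v ∉ A ∧ f v = c} / 2 < s)

theorem nonempty_iso_of_two_classes {V C : Type} [Fintype V] [DecidableEq C] {G : SimpleGraph V}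
    {s : ℕ} (hs : s ≠ 0) (f : V → C) (hadj : ∀ u v, G.Adj u v ↔ u ≠ v ∧ f u = f v)
    (hf : ∀ v, Finset.card {w | f w = f v} = s) (hcard : Fintype.card V = 2 * s) :
    Nonempty (G ≃g SimpleGraph.fromRel (fun x y : Fin s ⊕ Fin s => x.isLeft = y.isLeft)) := by
  classical
  have hV : Nonempty V := Fintype.card_pos_iff.1 (by lia)
  obtain ⟨v₀⟩ := hV
  have hcompl : Finset.card {w | ¬ f w = f v₀} = s := by
    have := Finset.card_filter_add_card_filter_not (s := Finset.univ) (fun w => f w = f v₀)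
    rw [hf, Finset.card_univ] at this
    lia
  have hiff : ∀ u v, f u = f v ↔ (f u = f v₀ ↔ f v = f v₀) := by
    intro u v
    refine ⟨fun h => by rw [h], fun h => ?_⟩
    by_cases hv : f v = f v₀
    · rw [h.2 hv, hv]
    · have hsub : ({w | f w = f v} : Finset V) ⊆ ({w | ¬ f w = f v₀} : Finset V) := by
        intro w
        simp only [Finset.mem_filter, Finset.mem_univ, true_and]
        exact fun hw => hw ▸ hv
      have heq := Finset.eq_of_subset_of_card_le hsub (by rw [hf, hcompl])
      have hu : u ∈ ({w | ¬ f w = f v₀} : Finset V) := by simpa using fun hu => hv (h.1 hu)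
      rw [← heq] at hu
      simpa using hu
  let e₁ : {w // f w = f v₀} ≃ Fin s :=
    Fintype.equivFinOfCardEq (by rw [Fintype.card_subtype, hf])
  let e₂ : {w // ¬ f w = f v₀} ≃ Fin s :=
    Fintype.equivFinOfCardEq (by rw [Fintype.card_subtype, hcompl])
  let e : V ≃ Fin s ⊕ Fin s := (Equiv.sumCompl _).symm.trans (e₁.sumCongr e₂)
  have he : ∀ v, (e v).isLeft = true ↔ f v = f v₀ := by
    intro v
    by_cases hv : f v = f v₀
    · simp [e, hv, Equiv.sumCompl_symm_apply_of_pos]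
    · simp [e, hv, Equiv.sumCompl_symm_apply_of_neg]
  refine ⟨e, fun {u v} => ?_⟩
  rw [hadj, hiff, ← he, ← he, fromRel_adj, e.injective.ne_iff, ← Bool.eq_iff_iff,
    eq_comm (a := (e v).isLeft), or_self]

theorem mul_min_pred_le (t m : ℕ) : m * min (m - 1) (2 * t) ≤ 2 * (m / 2) * (2 * t + 1) := by
  rcases Nat.even_or_odd' m with ⟨k, rfl | rfl⟩
  · have : 2 * k / 2 = k := by lia
    rw [this]
    exact Nat.mul_le_mul_left _ ((min_le_right _ _).trans (Nat.le_succ _))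
  · have : (2 * k + 1) / 2 = k := by lia
    rw [this]
    rcases le_total k t with h | h
    · rw [min_eq_left (by lia)]
      have : 2 * k + 1 - 1 = 2 * k := by lia
      rw [this]
      nlinarith
    · rw [min_eq_right (by lia)]
      nlinarith

theorem eq_of_mul_min_pred_eq {t m : ℕ} (hm : 2 ≤ m)
    (h : m * min (m - 1) (2 * t) = 2 * (m / 2) * (2 * t + 1)) : m = 2 * t + 1 := by
  rcases Nat.even_or_odd' m with ⟨k, rfl | rfl⟩
  · have : 2 * k / 2 = k := by lia
    rw [this] at h
    have := Nat.mul_left_cancel (by lia) h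
    lia
  · have : (2 * k + 1) / 2 = k := by lia
    rw [this] at h
    rcases lt_trichotomy k t with hk | hk | hk
    · rw [min_eq_left (by lia)] at h
      have : 2 * k + 1 - 1 = 2 * k := by lia
      rw [this] at h
      nlinarith
    · rw [hk]
    · rw [min_eq_right (by lia)] at h
      nlinarith

/-- If removing `A` splits `G` into the classes of `f`, then the degree sum of `G` is bounded by the
contribution of `A` plus the contributions of the classes. -/
theorem sum_degree_le_of_barrier {V C : Type} [Fintype V] [DecidableEq V] [Fintype C]
    [DecidableEq C] {G : SimpleGraph V} [DecidableRel G.Adj] {d : ℕ} (hd : ∀ v, G.degree v ≤ d)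
    {A : Finset V} {f : V → C} (hf : ∀ u v, G.Adj u v → u ∉ A → v ∉ A → f u = f v) :
    ∑ v, G.degree v ≤ 2 * (A.card * d) +
      ∑ c, Finset.card {v | v ∉ A ∧ f v = c} * min (Finset.card {v | v ∉ A ∧ f v = c} - 1) d := by
  have hsplit : ∀ v, G.degree v =
      Finset.card (A.bipartiteAbove G.Adj v) + Finset.card (Aᶜ.bipartiteAbove G.Adj v) := by
    intro v
    rw [← card_neighborFinset_eq_degree, neighborFinset_eq_filter,
      ← Finset.card_union_of_disjoint, Finset.bipartiteAbove, Finset.bipartiteAbove,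
      ← Finset.filter_union, Finset.union_compl]
    exact Finset.disjoint_filter_filter disjoint_compl_right
  have hA : ∑ v ∈ A, G.degree v ≤ A.card * d := Finset.sum_le_card_nsmul _ _ _ fun v _ => hd v
  have hcross : ∑ v ∈ Aᶜ, Finset.card (A.bipartiteAbove G.Adj v) ≤ A.card * d := by
    rw [Finset.sum_card_bipartiteAbove_eq_sum_card_bipartiteBelow]
    refine Finset.sum_le_card_nsmul _ _ _ fun v _ => le_trans (Finset.card_le_card ?_) (hd v)
    intro w hw
    rw [mem_neighborFinset]
    exact ((Finset.mem_bipartiteBelow _).1 hw).2.symm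
  have hin : ∑ v ∈ Aᶜ, Finset.card (Aᶜ.bipartiteAbove G.Adj v) ≤
      ∑ v ∈ Aᶜ, min (Finset.card {w | w ∉ A ∧ f w = f v} - 1) d := by
    refine Finset.sum_le_sum fun v hv => le_min ?_ ((hsplit v ▸ Nat.le_add_left _ _).trans (hd v))
    rw [Finset.mem_compl] at hv
    rw [← Finset.card_erase_of_mem (a := v) (by simpa using hv)]
    refine Finset.card_le_card fun w hw => ?_
    rw [Finset.mem_bipartiteAbove _, Finset.mem_compl] at hw
    simp [hw.1, hw.2.ne', hf v w hw.2 hv hw.1]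
  have hclass : ∑ v ∈ Aᶜ, min (Finset.card {w | w ∉ A ∧ f w = f v} - 1) d =
      ∑ c, Finset.card {v | v ∉ A ∧ f v = c} * min (Finset.card {v | v ∉ A ∧ f v = c} - 1) d := by
    rw [← Finset.sum_fiberwise Aᶜ f]
    refine Finset.sum_congr rfl fun c _ => ?_
    rw [Finset.sum_congr rfl (g := fun _ => min (Finset.card {v | v ∉ A ∧ f v = c} - 1) d),
      Finset.sum_const, smul_eq_mul]
    · congr 2
      ext v
      simp
    · intro v hv
      rw [(Finset.mem_filter.1 hv).2]
  rw [← Finset.sum_add_sum_compl A, Finset.sum_congr (s₁ := Aᶜ) rfl fun v _ => hsplit v,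
    Finset.sum_add_distrib]
  lia

/-- for odd `s ≥ 3`, any graph with `Δ < s`, `ν < s`, no isolated vertices
and exactly `s(s-1)` edges is two disjoint copies of `K_s`. -/
theorem stmt_13 {s : ℕ} (hs3 : 3 ≤ s) (hodd : Odd s) {V : Type} [Fintype V]
    (G : SimpleGraph V) (hΔ : ∀ v : V, (G.neighborSet v).ncard < s) (hν : nu G < s)
    (hniso : ∀ v : V, ∃ w : V, G.Adj v w)
    (hE : G.edgeSet.ncard = s * (s - 1)) :
    Nonempty (G ≃g SimpleGraph.fromRel (fun x y : Fin s ⊕ Fin s => x.isLeft = y.isLeft)) := by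
  classical
  obtain ⟨t, rfl⟩ := hodd
  have hdeg : ∀ v, G.degree v ≤ 2 * t := by
    intro v
    have := hΔ v
    rw [Set.ncard_eq_toFinset_card'] at this
    exact Nat.lt_succ_iff.1 this
  have hsum : ∑ v, G.degree v = 2 * ((2 * t + 1) * (2 * t)) := by
    rw [sum_degrees_eq_twice_card_edges, edgeFinset, ← Set.ncard_eq_toFinset_card', hE]
    simp
  obtain ⟨C, _, _, A, f, hf, hAf⟩ := exists_barrier_of_nu_lt hν
  have hle := sum_degree_le_of_barrier hdeg hf
  have hle' := Finset.sum_le_sum fun c (_ : c ∈ Finset.univ) =>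
    mul_min_pred_le t (Finset.card {v | v ∉ A ∧ f v = c})
  have hfac : ∑ c, 2 * (Finset.card {v | v ∉ A ∧ f v = c} / 2) * (2 * t + 1) =
      2 * (∑ c, Finset.card {v | v ∉ A ∧ f v = c} / 2) * (2 * t + 1) := by
    rw [← Finset.sum_mul, Finset.mul_sum]
  have hA : A = ∅ := by
    rw [← Finset.card_eq_zero]
    rw [hfac] at hle'
    by_contra hne
    have := Nat.pos_of_ne_zero hne
    nlinarith
  subst hA
  simp only [Finset.notMem_empty, not_false_eq_true, true_and, true_implies, Finset.card_empty,
    zero_mul, mul_zero, zero_add] at hf hAf hle hle' hfac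
  have hsum_eq : ∑ c, Finset.card {v | f v = c} * min (Finset.card {v | f v = c} - 1) (2 * t) =
      ∑ c, 2 * (Finset.card {v | f v = c} / 2) * (2 * t + 1) := by
    refine le_antisymm hle' ?_
    rw [hfac]
    nlinarith
  have hclass := (Finset.sum_eq_sum_iff_of_le fun c _ =>
    mul_min_pred_le t (Finset.card {v | f v = c})).1 hsum_eq
  have hsize : ∀ v, Finset.card {w | f w = f v} = 2 * t + 1 := by
    intro v
    refine eq_of_mul_min_pred_eq ?_ (hclass _ (Finset.mem_univ _))
    obtain ⟨w, hw⟩ := hniso v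
    exact Finset.one_lt_card.2 ⟨v, by simp, w, by simp [hf v w hw], hw.ne⟩
  have hcard : Fintype.card V = 2 * (2 * t + 1) := by
    have h1 : ∑ c, Finset.card {v | f v = c} * min (Finset.card {v | f v = c} - 1) (2 * t) =
        Fintype.card V * (2 * t) := by
      rw [← Finset.card_univ, Finset.card_eq_sum_card_fiberwise (f := f) (t := Finset.univ)
        (by simp), Finset.sum_mul]
      refine Finset.sum_congr rfl fun c _ => ?_
      rcases Finset.eq_empty_or_nonempty ({v | f v = c} : Finset V) with h | ⟨v, hv⟩
      · simp [h]
      · obtain rfl : f v = c := by simpa using hv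
        simp [hsize]
    refine Nat.eq_of_mul_eq_mul_right (by lia : 0 < 2 * t) ?_
    nlinarith
  have hreg : ∀ v, G.degree v = 2 * t := by
    have := (Finset.sum_eq_sum_iff_of_le (s := Finset.univ) fun v _ => hdeg v).1 (by
      rw [hsum, Finset.sum_const, Finset.card_univ, hcard, smul_eq_mul, mul_assoc])
    exact fun v => this v (Finset.mem_univ v)
  refine nonempty_iso_of_two_classes (by lia) f (fun u v => ⟨fun h => ⟨h.ne, hf u v h⟩, ?_⟩)
    hsize hcard
  rintro ⟨hne, huv⟩
  have hsub : G.neighborFinset u ⊆ ({w | f w = f u} : Finset V).erase u := by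
    intro w hw
    rw [mem_neighborFinset] at hw
    simp [hw.ne', hf u w hw]
  have heq := Finset.eq_of_subset_of_card_le hsub (by
    rw [Finset.card_erase_of_mem (by simp), hsize, card_neighborFinset_eq_degree, hreg,
      Nat.add_sub_cancel])
  rw [← mem_neighborFinset, heq]
  simp [hne.symm, huv]
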